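/- If G is a graph of order at least 4 obtained from a triangle xyz by attaching pendant leaves to some of the vertices x, y, z, then G is not equimatchable (and hence not well-edge-dominated). -/

import Mathlib

/-- `F` is an edge dominating set of `G`: every edge of `G` is in `F` or shares a
vertex with an edge of `F` (edges of `F` themselves share a vertex with themselves). -/
def IsEDS {V : Type*} (G : SimpleGraph V) (F : Finset (Sym2 V)) : Prop :=
  ↑F ⊆ G.edgeSet ∧ ∀ e ∈ G.edgeSet, ∃ f ∈ F, ∃ v : V, v ∈ e ∧ v ∈ f

/-- `F` is a minimal edge dominating set of `G`. -/
def IsMinEDS {V : Type*} (G : SimpleGraph V) (F : Finset (Sym2 V)) : Prop :=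
  IsEDS G F ∧ ∀ F' ⊂ F, ¬ IsEDS G F'

/-- `G` is well-edge-dominated: all minimal edge dominating sets have the same size. -/
def WellEdgeDominated {V : Type*} (G : SimpleGraph V) : Prop :=
  ∀ F₁ F₂ : Finset (Sym2 V), IsMinEDS G F₁ → IsMinEDS G F₂ → F₁.card = F₂.card

/-- `M` is a matching of `G`: a set of pairwise vertex-disjoint edges. -/
def IsMatchingSet {V : Type*} (G : SimpleGraph V) (M : Finset (Sym2 V)) : Prop :=
  ↑M ⊆ G.edgeSet ∧ ∀ e ∈ M, ∀ f ∈ M, e ≠ f → ∀ v : V, ¬ (v ∈ e ∧ v ∈ f)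

/-- `M` is a maximal matching of `G`: a matching such that every edge of `G`
shares a vertex with an edge of `M` (so no edge can be added). -/
def IsMaximalMatching {V : Type*} (G : SimpleGraph V) (M : Finset (Sym2 V)) : Prop :=
  IsMatchingSet G M ∧ ∀ e ∈ G.edgeSet, ∃ f ∈ M, ∃ v : V, v ∈ e ∧ v ∈ f

/-- `G` is equimatchable: all maximal matchings have the same size. -/
def Equimatchable {V : Type*} (G : SimpleGraph V) : Prop :=
  ∀ M₁ M₂ : Finset (Sym2 V), IsMaximalMatching G M₁ → IsMaximalMatching G M₂ →
    M₁.card = M₂.card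


/-- A triangle with pendant leaves attached (at least one leaf, so order ≥ 4)
is not equimatchable. -/
theorem triangle_with_leaves_not_equimatchable
    (L : Type*) [Fintype L] [Nonempty L] (l : L → Fin 3) :
    ¬ Equimatchable (SimpleGraph.fromRel (fun a b : Fin 3 ⊕ L =>
      match a, b with
      | Sum.inl _, Sum.inl _ => True
      | Sum.inl i, Sum.inr v => l v = i
      | _, _ => False)) := by
  classical
  set G := (SimpleGraph.fromRel (fun a b : Fin 3 ⊕ L =>
      match a, b with
      | Sum.inl _, Sum.inl _ => True
      | Sum.inl i, Sum.inr v => l v = i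
      | _, _ => False)) with hG
  have tri : ∀ i j : Fin 3, i ≠ j → s(Sum.inl i, Sum.inl j) ∈ G.edgeSet := by
    intro i j hij
    simp [hG, hij]
  have leaf : ∀ v : L, s(Sum.inl (l v), Sum.inr v) ∈ G.edgeSet := by
    intro v
    simp [hG]
  have edge : ∀ e ∈ G.edgeSet, (∃ i j : Fin 3, i ≠ j ∧ Sum.inl i ∈ e ∧ Sum.inl j ∈ e) ∨
      ∃ v : L, Sum.inl (l v) ∈ e := by
    intro e
    induction e using Sym2.ind with
    | _ a b =>
      intro he
      rcases a with i | v <;> rcases b with j | w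
      · left
        refine ⟨i, j, ?_, by simp, by simp⟩
        rintro rfl
        simp at he
      · right
        refine ⟨w, ?_⟩
        simp [hG] at he
        simp [he]
      · right
        refine ⟨v, ?_⟩
        simp [hG] at he
        simp [he]
      · simp [hG] at he
  have f3 : ∀ i j : Fin 3, j = i ∨ j = i + 1 ∨ j = i + 2 := by decide
  have n1 : ∀ i : Fin 3, i ≠ i + 1 := by decide
  have n2 : ∀ i : Fin 3, i ≠ i + 2 := by decide
  have n3 : ∀ i : Fin 3, i + 1 ≠ i + 2 := by decide
  -- the matching consisting of a pendant edge and the opposite triangle edge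
  have two : ∀ v : L, IsMaximalMatching G
      {s(Sum.inl (l v), Sum.inr v), s(Sum.inl (l v + 1), Sum.inl (l v + 2))} := by
    intro v
    refine ⟨⟨?_, ?_⟩, ?_⟩
    · intro e he
      simp only [Finset.coe_insert, Finset.coe_singleton, Set.mem_insert_iff,
        Set.mem_singleton_iff] at he
      rcases he with rfl | rfl
      · exact leaf v
      · exact tri _ _ (n3 _)
    · intro e he f hf hef w hw
      have h1 := n1 (l v)
      have h2 := n2 (l v)
      simp only [Finset.mem_insert, Finset.mem_singleton] at he hf
      rcases he with rfl | rfl <;> rcases hf with rfl | rfl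
      · exact hef rfl
      · simp only [Sym2.mem_iff] at hw
        grind
      · simp only [Sym2.mem_iff] at hw
        grind
      · exact hef rfl
    · intro e he
      obtain ⟨k, hk⟩ : ∃ k : Fin 3, Sum.inl k ∈ e := by
        rcases edge e he with ⟨i, _, _, h, _⟩ | ⟨w, h⟩
        exacts [⟨_, h⟩, ⟨_, h⟩]
      rcases f3 (l v) k with h | h | h
      · exact ⟨_, Finset.mem_insert_self _ _, _, hk, by simp [h]⟩
      · exact ⟨s(Sum.inl (l v + 1), Sum.inl (l v + 2)), by simp, _, hk, by simp [h]⟩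
      · exact ⟨s(Sum.inl (l v + 1), Sum.inl (l v + 2)), by simp, _, hk, by simp [h]⟩
  have card2 : ∀ v : L, Finset.card
      ({s(Sum.inl (l v), Sum.inr v), s(Sum.inl (l v + 1), Sum.inl (l v + 2))} :
        Finset (Sym2 (Fin 3 ⊕ L))) = 2 := by
    intro v
    apply Finset.card_pair
    simp
  intro H
  by_cases hs : Function.Surjective l
  · -- every triangle vertex has a leaf: three pendant edges
    choose g hg using hs
    have inj : Function.Injective
        (fun i : Fin 3 => (s(Sum.inl i, Sum.inr (g i)) : Sym2 (Fin 3 ⊕ L))) := by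
      intro i j hij
      simp at hij
      exact hij.1
    have three : IsMaximalMatching G
        (Finset.univ.image fun i : Fin 3 => s(Sum.inl i, Sum.inr (g i))) := by
      refine ⟨⟨?_, ?_⟩, ?_⟩
      · intro e he
        simp only [Finset.coe_image, Finset.coe_univ, Set.image_univ, Set.mem_range] at he
        obtain ⟨i, rfl⟩ := he
        have := leaf (g i)
        rwa [hg] at this
      · intro e he f hf hef w hw
        simp only [Finset.mem_image, Finset.mem_univ, true_and] at he hf
        obtain ⟨i, rfl⟩ := he
        obtain ⟨j, rfl⟩ := hf
        apply hef
        have hij : i = j := by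
          simp only [Sym2.mem_iff] at hw
          have h1 := hg i
          have h2 := hg j
          grind
        rw [hij]
      · intro e he
        obtain ⟨k, hk⟩ : ∃ k : Fin 3, Sum.inl k ∈ e := by
          rcases edge e he with ⟨i, _, _, h, _⟩ | ⟨w, h⟩
          exacts [⟨_, h⟩, ⟨_, h⟩]
        exact ⟨_, Finset.mem_image_of_mem _ (Finset.mem_univ k), _, hk, by simp⟩
    have := H _ _ (two (g 0)) three
    rw [card2, Finset.card_image_of_injective _ inj] at this
    simp at this
  · -- some triangle vertex has no leaf: the opposite edge alone
    obtain ⟨v⟩ := ‹Nonempty L›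
    simp only [Function.Surjective, not_forall, not_exists] at hs
    obtain ⟨i, hi⟩ := hs
    have one : IsMaximalMatching G {s(Sum.inl (i + 1), Sum.inl (i + 2))} := by
      refine ⟨⟨?_, ?_⟩, ?_⟩
      · intro e he
        simp only [Finset.coe_singleton, Set.mem_singleton_iff] at he
        subst he
        exact tri _ _ (n3 _)
      · intro e he f hf hef
        simp only [Finset.mem_singleton] at he hf
        exact absurd (he.trans hf.symm) hef
      · intro e he
        obtain ⟨k, hki, hk⟩ : ∃ k : Fin 3, k ≠ i ∧ Sum.inl k ∈ e := by
          rcases edge e he with ⟨a, b, hab, ha, hb⟩ | ⟨w, h⟩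
          · by_cases hai : a = i
            · exact ⟨b, fun h => hab (hai.trans h.symm), hb⟩
            · exact ⟨a, hai, ha⟩
          · exact ⟨_, hi w, h⟩
        refine ⟨_, Finset.mem_singleton_self _, _, hk, ?_⟩
        rcases f3 i k with h | h | h
        · exact absurd h hki
        · simp [h]
        · simp [h]
    have := H _ _ (two v) one
    rw [card2] at this
    simp at this
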